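/- arXiv:2505.17216 — 3 statements merged into one kernel-verified Lean document; each statement's English description precedes it below -/
import Mathlib

section
/- Let N ≥ 2 be an integer, g > 0, h > 0, u_m, α₂, …, α_N real numbers, and α₁ a nonzero real number. Then the matrix A^{PMHSWME}_p has N+2 pairwise distinct real eigenvalues, namely the numbers u_m + α₁·r for each of the N real roots r of P'_{N+1}, together with u_m ± √(gh + α₁² + Σ_{i=2}^N α_i²/(2i+1)); in particular, A^{PMHSWME}_p is diagonalizable over ℝ. -/
open Polynomial

/-- The Legendre polynomial of degree `n` (Rodrigues' formula), normalized so `P n 1 = 1`. -/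
noncomputable def legendre (n : ℕ) : Polynomial ℝ :=
  ((2 ^ n * n.factorial : ℝ))⁻¹ • (derivative^[n] ((X ^ 2 - 1) ^ n))

/-- Entry `(i,j)` (0-based) of the tridiagonal matrix `A₂`. -/
noncomputable def A2entry (α1 : ℝ) (i j : ℕ) : ℝ :=
  if j = i + 1 then ((i : ℝ) + 3) / (2 * (i : ℝ) + 5) * α1
  else if i = j + 1 then ((j : ℝ) + 1) / (2 * (j : ℝ) + 3) * α1
  else 0

/-- The PMHSWME system matrix in primitive variables. -/
noncomputable def APMHSWMEp (N : ℕ) (g h um : ℝ) (α : ℕ → ℝ) :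
    Matrix (Fin (N + 2)) (Fin (N + 2)) ℝ := fun r c =>
  if r.val = 0 then (if c.val = 0 then um else if c.val = 1 then h else 0)
  else if r.val = 1 then
    (if c.val = 0 then g + (1 / h) * ∑ j ∈ Finset.Icc 1 N, (α j) ^ 2 / (2 * (j : ℝ) + 1)
     else if c.val = 1 then um
     else 2 / (2 * (c.val : ℝ) - 1) * α (c.val - 1))
  else if c.val = 0 then (if r.val = 3 then -((α 1) ^ 2) / (3 * h) else 0)
  else if c.val = 1 then (if r.val = 2 then α 1 else 0)
  else (if r = c then um else 0) + A2entry (α 1) (r.val - 2) (c.val - 2)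

/-- Rolle's theorem, counting zeros in an interval: if `p` has the zeros `s` in `[a, b]`, then `p'`
has at least `#s - 1` zeros in `(a, b)`. -/
lemma card_le_card_roots_derivative_Ioo {p : ℝ[X]} (hp : derivative p ≠ 0) {a b : ℝ}
    {s : Finset ℝ} (hs : ∀ x ∈ s, x ∈ Set.Icc a b ∧ p.IsRoot x) :
    s.card ≤ ((derivative p).roots.toFinset.filter (· ∈ Set.Ioo a b)).card + 1 := by
  refine Finset.card_le_of_interleaved fun x hx y hy hxy _ => ?_
  obtain ⟨⟨hax, -⟩, hpx⟩ := hs x hx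
  obtain ⟨⟨-, hyb⟩, hpy⟩ := hs y hy
  obtain ⟨z, ⟨hxz, hzy⟩, hz⟩ := exists_deriv_eq_zero hxy p.continuousOn (hpx.trans hpy.symm)
  rw [Polynomial.deriv] at hz
  refine ⟨z, ?_, hxz, hzy⟩
  simp only [Finset.mem_filter, Multiset.mem_toFinset, mem_roots hp]
  exact ⟨hz, hax.trans_lt hxz, hzy.trans_le hyb⟩

lemma natDegree_iterate_derivative_eq (p : ℝ[X]) (k : ℕ) :
    (derivative^[k] p).natDegree = p.natDegree - k := by
  induction k with
  | zero => simp
  | succ k ih => rw [Function.iterate_succ_apply', natDegree_derivative, ih, Nat.sub_sub]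

lemma natDegree_X_sq_sub_one_pow (n : ℕ) : ((X ^ 2 - 1 : ℝ[X]) ^ n).natDegree = 2 * n := by
  rw [natDegree_pow, ← C_1, natDegree_X_pow_sub_C, mul_comm]

lemma isRoot_iterate_derivative_X_sq_sub_one_pow {n k : ℕ} (hk : k < n) {x : ℝ}
    (hx : x ^ 2 = 1) : (derivative^[k] ((X ^ 2 - 1 : ℝ[X]) ^ n)).IsRoot x := by
  obtain ⟨q, hq⟩ := pow_sub_dvd_iterate_derivative_pow (X ^ 2 - 1 : ℝ[X]) n k
  have : n - k ≠ 0 := by omega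
  simp [hq, hx, this]

lemma le_card_roots_iterate_derivative_Ioo {n k : ℕ} (hk : k ≤ n) :
    k ≤ ((derivative^[k] ((X ^ 2 - 1 : ℝ[X]) ^ n)).roots.toFinset.filter
      (· ∈ Set.Ioo (-1) 1)).card := by
  induction k with
  | zero => simp
  | succ k ih =>
    specialize ih (by omega)
    set p := derivative^[k] ((X ^ 2 - 1 : ℝ[X]) ^ n) with hp
    set s := p.roots.toFinset.filter (· ∈ Set.Ioo (-1 : ℝ) 1) with hs
    have hp0 : derivative p ≠ 0 := by
      rw [derivative_ne_zero, hp, natDegree_iterate_derivative_eq, natDegree_X_sq_sub_one_pow]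
      omega
    rw [Function.iterate_succ_apply', ← hp]
    have h1 : (1 : ℝ) ∉ s := by simp [hs]
    have h2 : (-1 : ℝ) ∉ insert 1 s := by
      rw [Finset.mem_insert, not_or]
      exact ⟨by norm_num, by simp [hs]⟩
    have hcard := card_le_card_roots_derivative_Ioo hp0 (a := -1) (b := 1)
      (s := insert (-1) (insert 1 s)) fun x hx => by
        simp only [Finset.mem_insert] at hx
        rcases hx with rfl | rfl | hx
        · exact ⟨by norm_num, isRoot_iterate_derivative_X_sq_sub_one_pow hk (by norm_num)⟩
        · exact ⟨by norm_num, isRoot_iterate_derivative_X_sq_sub_one_pow hk (by norm_num)⟩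
        · rw [hs, Finset.mem_filter, Multiset.mem_toFinset] at hx
          exact ⟨Set.Ioo_subset_Icc_self hx.2, isRoot_of_mem_roots hx.1⟩
    rw [Finset.card_insert_of_notMem h2, Finset.card_insert_of_notMem h1] at hcard
    omega

lemma legendre_scale_ne_zero (n : ℕ) : ((2 ^ n * n.factorial : ℝ))⁻¹ ≠ 0 := by positivity

lemma legendre_scale_succ (n : ℕ) :
    ((2 ^ (n + 1) * (n + 1).factorial : ℝ))⁻¹ * (2 * ((n : ℝ) + 1)) =
      ((2 ^ n * n.factorial : ℝ))⁻¹ := by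
  rw [Nat.factorial_succ]
  push_cast
  field_simp
  ring

lemma derivative_legendre (n : ℕ) : derivative (legendre n) =
    ((2 ^ n * n.factorial : ℝ))⁻¹ • derivative^[n + 1] ((X ^ 2 - 1) ^ n) := by
  rw [legendre, derivative_smul, Function.iterate_succ_apply']

lemma derivative_legendre_succ_ne_zero (n : ℕ) : derivative (legendre (n + 1)) ≠ 0 := by
  rw [legendre, derivative_smul, smul_ne_zero_iff, derivative_ne_zero,
    natDegree_iterate_derivative_eq, natDegree_X_sq_sub_one_pow]
  exact ⟨legendre_scale_ne_zero _, by omega⟩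

/-- `P'_{n+1}` has exactly `n` distinct real zeros, all of them in `(-1, 1)`. -/
lemma roots_derivative_legendre (n : ℕ) :
    (derivative (legendre (n + 1))).roots.toFinset.card = n ∧
      ∀ x, (derivative (legendre (n + 1))).IsRoot x → x ∈ Set.Ioo (-1 : ℝ) 1 := by
  have hne := derivative_legendre_succ_ne_zero n
  set q := derivative (legendre (n + 1)) with hq
  have hle : q.roots.toFinset.card ≤ n := by
    refine (Multiset.toFinset_card_le _).trans ((card_roots' q).trans ?_)
    rw [hq, derivative_legendre]
    refine (natDegree_smul_le _ _).trans ?_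
    rw [natDegree_iterate_derivative_eq, natDegree_X_sq_sub_one_pow]
    omega
  have hroots : q.roots =
      (derivative (derivative^[n + 1] ((X ^ 2 - 1 : ℝ[X]) ^ (n + 1)))).roots := by
    rw [hq, derivative_legendre, roots_smul_nonzero _ (legendre_scale_ne_zero _),
      Function.iterate_succ_apply' _ (n + 1)]
  have hge : n ≤ (q.roots.toFinset.filter (· ∈ Set.Ioo (-1 : ℝ) 1)).card := by
    have hcard := (le_card_roots_iterate_derivative_Ioo (le_refl (n + 1))).trans
      (card_le_card_roots_derivative_Ioo (p := derivative^[n + 1] ((X ^ 2 - 1 : ℝ[X]) ^ (n + 1)))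
        (a := -1) (b := 1) ?_ fun x hx => ?_)
    · rw [hroots]
      omega
    · intro h
      rw [hq, derivative_legendre, Function.iterate_succ_apply', h, smul_zero] at hne
      exact hne rfl
    · rw [Finset.mem_filter, Multiset.mem_toFinset] at hx
      exact ⟨Set.Ioo_subset_Icc_self hx.2, isRoot_of_mem_roots hx.1⟩
  have heq := Finset.eq_of_subset_of_card_le
    (Finset.filter_subset (· ∈ Set.Ioo (-1 : ℝ) 1) q.roots.toFinset) (hle.trans hge)
  refine ⟨hle.antisymm (heq ▸ hge), fun x hx => ?_⟩
  have hmem : x ∈ q.roots.toFinset := Multiset.mem_toFinset.2 ((mem_roots hne).2 hx)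
  rw [← heq] at hmem
  exact (Finset.mem_filter.1 hmem).2

lemma derivative_legendre_succ (n : ℕ) : derivative (legendre (n + 1)) =
    X * derivative (legendre n) + ((n : ℝ) + 1) • legendre n := by
  have h : derivative ((X ^ 2 - 1 : ℝ[X]) ^ (n + 1)) =
      (2 * ((n : ℝ) + 1)) • ((X ^ 2 - 1) ^ n * X) := by
    simp [derivative_pow, smul_eq_C_mul]
    ring
  rw [derivative_legendre, derivative_legendre, legendre, Function.iterate_succ_apply, h,
    iterate_derivative_smul, iterate_derivative_mul_X, smul_smul, legendre_scale_succ,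
    Nat.add_sub_cancel, mul_smul_comm, X_mul, ← Nat.cast_smul_eq_nsmul ℝ, Nat.cast_succ]
  module

lemma derivative_legendre_add_two (n : ℕ) : derivative (legendre (n + 2)) =
    derivative (legendre n) + (2 * (n : ℝ) + 3) • legendre (n + 1) := by
  have h : derivative (derivative ((X ^ 2 - 1 : ℝ[X]) ^ (n + 2))) =
      (2 * (((n + 1 : ℕ) : ℝ) + 1)) • ((2 * (n : ℝ) + 3) • (X ^ 2 - 1) ^ (n + 1) +
        (2 * ((n : ℝ) + 1)) • (X ^ 2 - 1) ^ n) := by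
    simp [derivative_pow, smul_eq_C_mul]
    simp only [map_ofNat]
    ring
  rw [derivative_legendre, derivative_legendre, legendre, Function.iterate_succ_apply,
    Function.iterate_succ_apply, h, iterate_derivative_smul, iterate_map_add,
    iterate_derivative_smul, iterate_derivative_smul, smul_smul, legendre_scale_succ, smul_add,
    smul_smul _ (2 * ((n : ℝ) + 1)), legendre_scale_succ, smul_comm, add_comm]

/-- Three-term recurrence for the derivatives of the Legendre polynomials. -/
lemma derivative_legendre_recurrence (n : ℕ) (r : ℝ) :
    (2 * (n : ℝ) + 3) * r * (derivative (legendre (n + 1))).eval r =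
      ((n : ℝ) + 1) * (derivative (legendre (n + 2))).eval r +
        ((n : ℝ) + 2) * (derivative (legendre n)).eval r := by
  have h1 := congrArg (eval r) (derivative_legendre_succ (n + 1))
  have h2 := congrArg (eval r) (derivative_legendre_add_two n)
  simp only [eval_add, eval_mul, eval_X, eval_smul, smul_eq_mul] at h1 h2
  push_cast at h1
  linear_combination (-2 * (n : ℝ) - 3) * h1 + ((n : ℝ) + 2) * h2

namespace Matrix

variable {n K : Type*} [Fintype n] [DecidableEq n] [Field K]

lemma mem_spectrum_iff_det_eq_zero {A : Matrix n n K} {x : K} :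
    x ∈ spectrum K A ↔ (algebraMap K (Matrix n n K) x - A).det = 0 := by
  rw [spectrum.mem_iff, isUnit_iff_isUnit_det, isUnit_iff_ne_zero, not_not]

lemma mem_spectrum_of_mulVec {A : Matrix n n K} {x : K} {v : n → K} (hv : v ≠ 0)
    (h : A *ᵥ v = x • v) : x ∈ spectrum K A := by
  rw [mem_spectrum_iff_det_eq_zero, ← exists_mulVec_eq_zero_iff]
  exact ⟨v, hv, by rw [sub_mulVec, h, Algebra.algebraMap_eq_smul_one, smul_mulVec, one_mulVec,
    sub_self]⟩

lemma mem_spectrum_of_vecMul {A : Matrix n n K} {x : K} {v : n → K} (hv : v ≠ 0)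
    (h : v ᵥ* A = x • v) : x ∈ spectrum K A := by
  rw [mem_spectrum_iff_det_eq_zero, ← exists_vecMul_eq_zero_iff]
  exact ⟨v, hv, by rw [vecMul_sub, h, Algebra.algebraMap_eq_smul_one, vecMul_smul, vecMul_one,
    sub_self]⟩

/-- A square matrix of size `#S` whose spectrum contains `S` has spectrum `S` and is
diagonalizable. -/
lemma spectrum_eq_and_exists_diagonal {A : Matrix n n K} {S : Finset K}
    (hcard : S.card = Fintype.card n) (hS : ∀ x ∈ S, x ∈ spectrum K A) :
    spectrum K A = S ∧
      ∃ P D : Matrix n n K, IsUnit P ∧ D.IsDiag ∧ A = P * D * P⁻¹ := by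
  have e : n ≃ S := Fintype.equivOfCardEq (by simp [hcard])
  have hev (i : n) : ∃ v, Module.End.HasEigenvector (toLin' A) (e i : K) v := by
    refine Module.End.HasEigenvalue.exists_hasEigenvector ?_
    rw [Module.End.hasEigenvalue_iff_mem_spectrum, spectrum_toLin']
    exact hS _ (e i).2
  choose v hv using hev
  have hli := Module.End.eigenvectors_linearIndependent' (toLin' A) (fun i => (e i : K))
    (Subtype.val_injective.comp e.injective) v hv
  let P : Matrix n n K := of fun i j => v j i
  have hP : IsUnit P := linearIndependent_cols_iff_isUnit.1 hli
  let D : Matrix n n K := diagonal fun i => (e i : K)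
  have hAP : A * P = P * D := by
    ext i j
    have := congrFun (hv j).apply_eq_smul i
    rw [toLin'_apply] at this
    rw [mul_diagonal, mul_comm]
    exact this
  have hA : A = P * D * P⁻¹ := by
    rw [← hAP, mul_nonsing_inv_cancel_right _ _ ((isUnit_iff_isUnit_det P).1 hP)]
  refine ⟨?_, P, D, hP, isDiag_diagonal _, hA⟩
  obtain ⟨u, hu⟩ := hP
  rw [hA, ← hu, ← coe_units_inv, spectrum.units_conjugate, spectrum_diagonal]
  ext x
  constructor
  · rintro ⟨i, rfl⟩
    exact (e i).2
  · exact fun hx => ⟨e.symm ⟨x, hx⟩, by simp⟩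

end Matrix

lemma sum_mul_A2entry (a : ℝ) {ℓ : ℕ → ℝ} {N j : ℕ} (hj : j < N) (h0 : ℓ 0 = 0)
    (hN : ℓ (N + 1) = 0) :
    ∑ i ∈ Finset.range N, ℓ (i + 1) * A2entry a i j =
      a / (2 * (j : ℝ) + 3) * (((j : ℝ) + 1) * ℓ (j + 2) + ((j : ℝ) + 2) * ℓ j) := by
  have hsplit (i : ℕ) : ℓ (i + 1) * A2entry a i j =
      (if j = i + 1 then a / (2 * (j : ℝ) + 3) * (((j : ℝ) + 2) * ℓ j) else 0) +
        (if i = j + 1 then a / (2 * (j : ℝ) + 3) * (((j : ℝ) + 1) * ℓ (j + 2)) else 0) := by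
    unfold A2entry
    split_ifs with h1 h2 h2
    · omega
    · subst h1
      push_cast
      ring
    · subst h2
      ring
    · simp
  simp only [hsplit]
  rw [Finset.sum_add_distrib, Finset.sum_ite_eq', mul_add, add_comm]
  congr 1
  · split_ifs with h
    · rfl
    · rw [Finset.mem_range] at h
      rw [show j + 2 = N + 1 by omega, hN, mul_zero, mul_zero]
  · cases j with
    | zero => simp [h0]
    | succ k =>
      simp only [Nat.add_right_cancel_iff]
      rw [Finset.sum_ite_eq, if_pos (Finset.mem_range.2 (by omega))]

/-- The left eigenvector `(-α₁/h, 0, P₁'(r), …, P_N'(r))` of the system matrix. -/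
lemma exists_left_eigenvector_APMHSWMEp {N : ℕ} (hN : 2 ≤ N) (g um : ℝ) {h : ℝ} (hh : h ≠ 0)
    (α : ℕ → ℝ) {r : ℝ} (hr : (derivative (legendre (N + 1))).eval r = 0) :
    ∃ v : Fin (N + 2) → ℝ, v ≠ 0 ∧
      Matrix.vecMul v (APMHSWMEp N g h um α) = (um + α 1 * r) • v := by
  set ℓ : ℕ → ℝ := fun i => (derivative (legendre i)).eval r with hℓ
  have hrec (n : ℕ) : (2 * (n : ℝ) + 3) * r * ℓ (n + 1) =
      ((n : ℝ) + 1) * ℓ (n + 2) + ((n : ℝ) + 2) * ℓ n := derivative_legendre_recurrence n r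
  have h0 : ℓ 0 = 0 := by simp [hℓ, legendre]
  have h1 : ℓ 1 = 1 := by norm_num [hℓ, legendre]
  have h2 : ℓ 2 = 3 * r := by simpa [h0, h1] using (hrec 0).symm
  refine ⟨Fin.cons (-α 1 / h) (Fin.cons 0 fun i : Fin N => ℓ (i + 1)), fun hv => ?_, ?_⟩
  · have := congrFun hv (Fin.succ (Fin.succ ⟨0, by omega⟩))
    rw [Fin.cons_succ, Fin.cons_succ] at this
    simp [h1] at this
  obtain ⟨M, rfl⟩ : ∃ M, N = M + 2 := ⟨N - 2, by omega⟩
  ext c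
  rw [Matrix.vecMul, dotProduct, Fin.sum_univ_succ, Fin.sum_univ_succ]
  refine Fin.cases ?_ (Fin.cases ?_ fun j => ?_) c
  · simp [APMHSWMEp, Fin.sum_univ_succ, h2]
    field_simp
    ring
  · simp [APMHSWMEp, h1]
    field_simp
    ring
  · simp [APMHSWMEp]
    simp only [mul_add, Finset.sum_add_distrib]
    rw [Fin.sum_univ_eq_sum_range (fun i => ℓ (i + 1) * A2entry (α 1) i j),
      sum_mul_A2entry _ j.2 h0 hr, ← hrec]
    simp
    field_simp

/-- The right eigenvectors `(h, μ, α₁, 0, …, 0)` of the system matrix. -/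
lemma exists_right_eigenvector_APMHSWMEp {N : ℕ} (hN : 2 ≤ N) (g um : ℝ) {h : ℝ} (hh : h ≠ 0)
    (α : ℕ → ℝ) {μ : ℝ} (hμ : μ ^ 2 = g * h + (α 1) ^ 2 +
      ∑ i ∈ Finset.Icc 2 N, (α i) ^ 2 / (2 * (i : ℝ) + 1)) :
    ∃ v : Fin (N + 2) → ℝ, v ≠ 0 ∧
      Matrix.mulVec (APMHSWMEp N g h um α) v = (um + μ) • v := by
  obtain ⟨M, rfl⟩ : ∃ M, N = M + 2 := ⟨N - 2, by omega⟩
  refine ⟨Fin.cons h (Fin.cons μ (Fin.cons (α 1) 0)), fun hv => ?_, ?_⟩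
  · exact hh (congrFun hv 0)
  have hsum : ∑ i ∈ Finset.Icc 1 (M + 2), (α i) ^ 2 / (2 * (i : ℝ) + 1) =
      (α 1) ^ 2 / 3 + ∑ i ∈ Finset.Icc 2 (M + 2), (α i) ^ 2 / (2 * (i : ℝ) + 1) := by
    rw [← Finset.add_sum_Ioc_eq_sum_Icc (by omega)]
    norm_num
    rfl
  ext c
  rw [Matrix.mulVec, dotProduct, Fin.sum_univ_succ, Fin.sum_univ_succ, Fin.sum_univ_succ]
  refine Fin.cases ?_ (Fin.cases ?_ (Fin.cases ?_ (Fin.cases ?_ fun j => ?_))) c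
  · simp [APMHSWMEp, -Fin.succ_zero_eq_one, -Fin.succ_zero_eq_one', -Fin.succ_one_eq_two,
      -Fin.succ_one_eq_two']
    ring
  · simp [APMHSWMEp, -Fin.succ_zero_eq_one, -Fin.succ_zero_eq_one', -Fin.succ_one_eq_two,
      -Fin.succ_one_eq_two']
    rw [hsum]
    field_simp
    linear_combination -9 * hμ
  · simp [APMHSWMEp, A2entry, -Fin.succ_zero_eq_one, -Fin.succ_zero_eq_one', -Fin.succ_one_eq_two,
      -Fin.succ_one_eq_two']
    ring
  · simp [APMHSWMEp, A2entry, -Fin.succ_zero_eq_one, -Fin.succ_zero_eq_one', -Fin.succ_one_eq_two,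
      -Fin.succ_one_eq_two']
    field_simp
    ring
  · simp [APMHSWMEp, A2entry, -Fin.succ_zero_eq_one, -Fin.succ_zero_eq_one', -Fin.succ_one_eq_two,
      -Fin.succ_one_eq_two']

/-- The primitive PMHSWME system matrix has `N+2` pairwise distinct real eigenvalues:
`u_m + α₁·r` for the `N` real roots `r` of `P'_{N+1}`, together with
`u_m ± √(gh + α₁² + Σ_{i=2}^N α_i²/(2i+1))`; in particular it is real diagonalizable. -/
theorem stmt_16 (N : ℕ) (hN : 2 ≤ N) (g h um : ℝ) (hg : 0 < g) (hh : 0 < h)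
    (α : ℕ → ℝ) (hα1 : α 1 ≠ 0) :
    spectrum ℝ (APMHSWMEp N g h um α) =
        ((fun r => um + α 1 * r) '' {r : ℝ | (derivative (legendre (N + 1))).eval r = 0}) ∪
          {um + Real.sqrt (g * h + (α 1) ^ 2 +
              ∑ i ∈ Finset.Icc 2 N, (α i) ^ 2 / (2 * (i : ℝ) + 1)),
            um - Real.sqrt (g * h + (α 1) ^ 2 +
              ∑ i ∈ Finset.Icc 2 N, (α i) ^ 2 / (2 * (i : ℝ) + 1))} ∧
      (spectrum ℝ (APMHSWMEp N g h um α)).ncard = N + 2 ∧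
      ∃ P D : Matrix (Fin (N + 2)) (Fin (N + 2)) ℝ,
        IsUnit P ∧ D.IsDiag ∧ APMHSWMEp N g h um α = P * D * P⁻¹ := by
  set q := derivative (legendre (N + 1)) with hq
  set Q := g * h + (α 1) ^ 2 + ∑ i ∈ Finset.Icc 2 N, (α i) ^ 2 / (2 * (i : ℝ) + 1) with hQ
  obtain ⟨hcard, hroots⟩ := roots_derivative_legendre N
  have hq0 : q ≠ 0 := derivative_legendre_succ_ne_zero N
  have hα1Q : (α 1) ^ 2 < Q := by
    have h1 : 0 < g * h := mul_pos hg hh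
    have h2 : 0 ≤ ∑ i ∈ Finset.Icc 2 N, (α i) ^ 2 / (2 * (i : ℝ) + 1) :=
      Finset.sum_nonneg fun i _ => by positivity
    linarith
  have hQ0 : 0 < Q := (sq_nonneg _).trans_lt hα1Q
  have hsq : √Q ^ 2 = Q := Real.sq_sqrt hQ0.le
  have hsqrt : 0 < √Q := Real.sqrt_pos.2 hQ0
  have hinj : Function.Injective fun r => um + α 1 * r := fun r s hrs =>
    mul_left_cancel₀ hα1 (add_left_cancel hrs)
  let R : Finset ℝ := q.roots.toFinset.image fun r => um + α 1 * r
  have hR {x : ℝ} (hx : x ^ 2 = Q) : um + x ∉ R := by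
    intro hmem
    obtain ⟨r, hr, hrx⟩ := Finset.mem_image.1 hmem
    obtain ⟨hr1, hr2⟩ := hroots r (isRoot_of_mem_roots (Multiset.mem_toFinset.1 hr))
    have hrQ : (α 1) ^ 2 * r ^ 2 = Q := by rw [← hx, ← add_left_cancel hrx, mul_pow]
    have hr3 : r ^ 2 ≤ 1 := by nlinarith
    linarith [mul_le_of_le_one_right (sq_nonneg (α 1)) hr3]
  have hplus : um + √Q ∉ insert (um - √Q) R := by
    rw [Finset.mem_insert, not_or]
    exact ⟨by intro h; linarith, hR hsq⟩
  have hminus : um - √Q ∉ R := by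
    rw [sub_eq_add_neg]
    exact hR (by rw [neg_sq, hsq])
  let S : Finset ℝ := insert (um + √Q) (insert (um - √Q) R)
  have hScard : S.card = N + 2 := by
    rw [Finset.card_insert_of_notMem hplus, Finset.card_insert_of_notMem hminus,
      Finset.card_image_of_injective _ hinj, hcard]
  have hSspec : ∀ x ∈ S, x ∈ spectrum ℝ (APMHSWMEp N g h um α) := by
    intro x hx
    rcases Finset.mem_insert.1 hx with rfl | hx
    · obtain ⟨v, hv, hAv⟩ := exists_right_eigenvector_APMHSWMEp hN g um hh.ne' α hsq
      exact Matrix.mem_spectrum_of_mulVec hv hAv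
    rcases Finset.mem_insert.1 hx with rfl | hx
    · obtain ⟨v, hv, hAv⟩ := exists_right_eigenvector_APMHSWMEp hN g um hh.ne' α
        (μ := -√Q) (by rw [neg_sq, hsq])
      exact Matrix.mem_spectrum_of_mulVec hv hAv
    · obtain ⟨r, hr, rfl⟩ := Finset.mem_image.1 hx
      obtain ⟨v, hv, hAv⟩ := exists_left_eigenvector_APMHSWMEp hN g um hh.ne' α
        (isRoot_of_mem_roots (Multiset.mem_toFinset.1 hr))
      exact Matrix.mem_spectrum_of_vecMul hv hAv
  obtain ⟨hspec, hdiag⟩ :=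
    Matrix.spectrum_eq_and_exists_diagonal (hScard.trans (Fintype.card_fin _).symm) hSspec
  refine ⟨?_, by rw [hspec, Set.ncard_coe_finset, hScard], hdiag⟩
  have hrootSet : {r : ℝ | q.eval r = 0} = q.roots.toFinset := by
    ext r
    simp [hq0]
  rw [hspec, hrootSet, ← Finset.coe_image, Set.union_comm, Finset.coe_insert, Finset.coe_insert,
    Set.insert_union, Set.singleton_union]
end

section
/- Let N ≥ 2 be an integer, g, u_m, α₁, …, α_N real numbers, and h a nonzero real number. Then T · A^{PMHSWME}_p · T⁻¹ = A^{PMHSWME}_c, where T, A^{PMHSWME}_p and A^{PMHSWME}_c are the matrices defined in the context. -/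
/-- Transformation matrix `T` between primitive and convective variables. -/
noncomputable def Tmat (N : ℕ) (h um : ℝ) (α : ℕ → ℝ) :
    Matrix (Fin (N + 2)) (Fin (N + 2)) ℝ := fun r c =>
  if c.val = 0 then (if r.val = 0 then 1 else if r.val = 1 then um else α (r.val - 1))
  else if r = c then h else 0

/-- The PMHSWME system matrix in convective variables; for `r.val = 1 + i`, `i = 1,…,N`,
the first column is
`−u_m·α_i − u_m·α₁·δ_{i,1} − (α₁²/3)·δ_{i,2} − ((i−1)/(2i−1))·α₁·α_{i−1} − ((i+2)/(2i+3))·α₁·α_{i+1}`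
and the second column is `α_i + α₁·δ_{i,1}`. -/
noncomputable def APMHSWMEc (N : ℕ) (g h um : ℝ) (α : ℕ → ℝ) :
    Matrix (Fin (N + 2)) (Fin (N + 2)) ℝ := fun r c =>
  if r.val = 0 then (if c.val = 1 then 1 else 0)
  else if r.val = 1 then
    (if c.val = 0 then g * h - um ^ 2 - ∑ j ∈ Finset.Icc 1 N, (α j) ^ 2 / (2 * (j : ℝ) + 1)
     else if c.val = 1 then 2 * um
     else 2 / (2 * (c.val : ℝ) - 1) * α (c.val - 1))
  else if c.val = 0 then
    -um * α (r.val - 1) - um * α 1 * (if r.val = 2 then 1 else 0)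
      - (α 1) ^ 2 / 3 * (if r.val = 3 then 1 else 0)
      - ((r.val : ℝ) - 2) / (2 * (r.val : ℝ) - 3) * α 1 * α (r.val - 2)
      - ((r.val : ℝ) + 1) / (2 * (r.val : ℝ) + 1) * α 1 * α r.val
  else if c.val = 1 then α (r.val - 1) + α 1 * (if r.val = 2 then 1 else 0)
  else (if r = c then um else 0) + A2entry (α 1) (r.val - 2) (c.val - 2)

theorem A2entry_eq_add (a : ℝ) (i j : ℕ) :
    A2entry a i j = (if j = i + 1 then ((i : ℝ) + 3) / (2 * (i : ℝ) + 5) * a else 0)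
      + (if i = j + 1 then ((j : ℝ) + 1) / (2 * (j : ℝ) + 3) * a else 0) := by
  unfold A2entry
  split_ifs <;> first | omega | simp

/-- Action of `A₂` on the vector `(α₁, …, α_N)`, with the convention `α_{N+1} = 0`. -/
theorem sum_A2entry_mul (N : ℕ) (a : ℝ) (α : ℕ → ℝ) (hαtop : α (N + 1) = 0) (i : ℕ)
    (hi : i < N) :
    ∑ j : Fin N, A2entry a i j * α (j + 1) =
      ((i : ℝ) + 3) / (2 * (i : ℝ) + 5) * a * α (i + 2)
        + (i : ℝ) / (2 * (i : ℝ) + 1) * a * α i := by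
  rw [Fin.sum_univ_eq_sum_range (fun j => A2entry a i j * α (j + 1)) N]
  simp only [A2entry_eq_add, add_mul, ite_mul, zero_mul, Finset.sum_add_distrib]
  congr 1
  · rw [Finset.sum_ite_eq' (Finset.range N) (i + 1)]
    split_ifs with hmem
    · rfl
    · have : i + 1 = N := by
        rw [Finset.mem_range] at hmem
        omega
      rw [show i + 2 = N + 1 by omega, hαtop, mul_zero]
  · cases i with
    | zero => simp
    | succ k =>
      simp only [Nat.add_right_cancel_iff]
      rw [Finset.sum_ite_eq (Finset.range N) k, if_pos (Finset.mem_range.2 (by omega))]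
      push_cast
      ring

theorem Tmat_mul_apply_zero (N : ℕ) (h um : ℝ) (α : ℕ → ℝ)
    (M : Matrix (Fin (N + 2)) (Fin (N + 2)) ℝ) (c : Fin (N + 2)) :
    (Tmat N h um α * M) 0 c = M 0 c := by
  simp [Matrix.mul_apply, Fin.sum_univ_succ (n := N + 1), Tmat, (Fin.succ_ne_zero _).symm]

theorem Tmat_mul_apply_succ (N : ℕ) (h um : ℝ) (α : ℕ → ℝ)
    (M : Matrix (Fin (N + 2)) (Fin (N + 2)) ℝ) (r : Fin (N + 1)) (c : Fin (N + 2)) :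
    (Tmat N h um α * M) r.succ c = (if r = 0 then um else α r) * M 0 c + h * M r.succ c := by
  simp [Matrix.mul_apply, Fin.sum_univ_succ (n := N + 1), Tmat]

theorem mul_Tmat_apply_zero (N : ℕ) (h um : ℝ) (α : ℕ → ℝ)
    (M : Matrix (Fin (N + 2)) (Fin (N + 2)) ℝ) (r : Fin (N + 2)) :
    (M * Tmat N h um α) r 0 =
      M r 0 + M r 1 * um + ∑ j : Fin N, M r j.succ.succ * α (j + 1) := by
  simp [Matrix.mul_apply, Fin.sum_univ_succ, Tmat, add_assoc]

theorem mul_Tmat_apply_succ (N : ℕ) (h um : ℝ) (α : ℕ → ℝ)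
    (M : Matrix (Fin (N + 2)) (Fin (N + 2)) ℝ) (r : Fin (N + 2)) (c : Fin (N + 1)) :
    (M * Tmat N h um α) r c.succ = h * M r c.succ := by
  simp [Matrix.mul_apply, Tmat, mul_comm]

theorem det_Tmat (N : ℕ) (h um : ℝ) (α : ℕ → ℝ) : (Tmat N h um α).det = h ^ (N + 1) := by
  rw [Matrix.det_of_isLowerTriangular, Fin.prod_univ_succ]
  · simp [Tmat]
  · intro i j hij
    have hlt : i < j := hij
    have hj : (j : ℕ) ≠ 0 := by
      have := Fin.lt_def.1 hlt
      omega
    simp [Tmat, hj, hlt.ne]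

theorem Tmat_mul_APMHSWMEp (N : ℕ) (g um h : ℝ) (hh : h ≠ 0) (α : ℕ → ℝ)
    (hαtop : α (N + 1) = 0) :
    Tmat N h um α * APMHSWMEp N g h um α = APMHSWMEc N g h um α * Tmat N h um α := by
  ext r c
  induction r using Fin.cases with
  | zero =>
    rw [Tmat_mul_apply_zero]
    induction c using Fin.cases with
    | zero =>
      rw [mul_Tmat_apply_zero]
      simp [APMHSWMEp, APMHSWMEc]
    | succ c =>
      rw [mul_Tmat_apply_succ]
      simp [APMHSWMEp, APMHSWMEc]
  | succ r =>
    rw [Tmat_mul_apply_succ]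
    induction r using Fin.cases with
    | zero =>
      induction c using Fin.cases with
      | zero =>
        rw [mul_Tmat_apply_zero]
        have hsum : ∑ j : Fin N, APMHSWMEc N g h um α (Fin.succ 0) j.succ.succ * α (j + 1) =
            2 * ∑ j ∈ Finset.Icc 1 N, α j ^ 2 / (2 * (j : ℝ) + 1) := by
          rw [← Finset.Ico_add_one_right_eq_Icc, Finset.sum_Ico_eq_sum_range,
            Finset.mul_sum, Nat.add_sub_cancel,
            ← Fin.sum_univ_eq_sum_range
              (fun j => 2 * (α (1 + j) ^ 2 / (2 * ((1 + j : ℕ) : ℝ) + 1))) N]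
          refine Finset.sum_congr rfl fun j _ => ?_
          simp [APMHSWMEc]
          ring_nf
        rw [hsum]
        simp [APMHSWMEp, APMHSWMEc]
        field_simp
        ring
      | succ c =>
        rw [mul_Tmat_apply_succ]
        induction c using Fin.cases with
        | zero => simp [APMHSWMEp, APMHSWMEc]; ring
        | succ c => simp [APMHSWMEp, APMHSWMEc]
    | succ i =>
      induction c using Fin.cases with
      | zero =>
        rw [mul_Tmat_apply_zero]
        have hsum : ∑ j : Fin N, APMHSWMEc N g h um α i.succ.succ j.succ.succ * α (j + 1) =
            um * α (i + 1) + ∑ j : Fin N, A2entry (α 1) i j * α (j + 1) := by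
          simp [APMHSWMEc, add_mul, Finset.sum_add_distrib]
        rw [hsum, sum_A2entry_mul N (α 1) α hαtop i i.isLt]
        have h1 : (i : ℝ) + 1 + 1 - 2 = i := by ring
        have h2 : 2 * ((i : ℝ) + 1 + 1) - 3 = 2 * i + 1 := by ring
        have h3 : (i : ℝ) + 1 + 1 + 1 = i + 3 := by ring
        have h4 : 2 * ((i : ℝ) + 1 + 1) + 1 = 2 * i + 5 := by ring
        simp [APMHSWMEp, APMHSWMEc, h1, h2, h3, h4]
        split_ifs <;> field_simp <;> ring
      | succ c =>
        rw [mul_Tmat_apply_succ]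
        induction c using Fin.cases with
        | zero => simp [APMHSWMEp, APMHSWMEc]; split_ifs <;> ring
        | succ c => simp [APMHSWMEp, APMHSWMEc]

/-- Transforming the primitive PMHSWME system matrix back to convective variables yields the
convective PMHSWME system matrix (with the conventions `α₀ = 0`, `α_{N+1} = 0`). -/
theorem stmt_17 (N : ℕ) (hN : 2 ≤ N) (g um : ℝ) (h : ℝ) (hh : h ≠ 0) (α : ℕ → ℝ)
    (hα0 : α 0 = 0) (hαtop : α (N + 1) = 0) :
    Tmat N h um α * APMHSWMEp N g h um α * (Tmat N h um α)⁻¹ = APMHSWMEc N g h um α := by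
  rw [Tmat_mul_APMHSWMEp N g um h hh α hαtop]
  refine Matrix.mul_nonsing_inv_cancel_right _ _ ?_
  rw [det_Tmat]
  exact (pow_ne_zero _ hh).isUnit
end

section
/- Let N ≥ 1 be an integer, g > 0, h₀ > 0, h > 0 real numbers, u_{m,0} a nonzero real number, and u_m, α₁, …, α_N, α_{1,0}, …, α_{N,0} real numbers. Assume the steady-state invariants of the PMHSWME system: h·u_m = h₀·u_{m,0}, α_i·h₀ = α_{i,0}·h for every i = 1,…,N, and (1/2)g·h² + h·u_m² + Σ_{i=1}^N h·α_i²/(2i+1) = (1/2)g·h₀² + h₀·u_{m,0}² + Σ_{i=1}^N h₀·α_{i,0}²/(2i+1). Set Fr := u_{m,0}/√(g·h₀), Ma_i := α_{i,0}/u_{m,0} for i = 1,…,N, and x := h/h₀. Then either h = h₀, or −Fr² + (1/2)(x² + x) + Σ_{i=1}^N (Fr²·Ma_i²/(2i+1))·(x³ + x² + x) = 0. -/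
/-- Steady states of the PMHSWME system: given the steady-state invariants (constant discharge,
constant ratios `α_i/h`, and constant momentum flux), either `h = h₀` or the water height ratio
`x = h/h₀` satisfies
`−Fr² + (1/2)(x² + x) + Σ_{i=1}^N (Fr²·Ma_i²/(2i+1))(x³ + x² + x) = 0`,
where `Fr = u_{m,0}/√(gh₀)` and `Ma_i = α_{i,0}/u_{m,0}`. -/
theorem stmt_18 (N : ℕ) (hN : 1 ≤ N) (g h₀ h um₀ um : ℝ) (α α₀ : ℕ → ℝ)
    (hg : 0 < g) (hh₀ : 0 < h₀) (hh : 0 < h) (hum₀ : um₀ ≠ 0)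
    (inv1 : h * um = h₀ * um₀)
    (inv2 : ∀ i, 1 ≤ i → i ≤ N → α i * h₀ = α₀ i * h)
    (inv3 : 1 / 2 * g * h ^ 2 + h * um ^ 2 + ∑ i ∈ Finset.Icc 1 N, h * (α i) ^ 2 / (2 * (i : ℝ) + 1)
      = 1 / 2 * g * h₀ ^ 2 + h₀ * um₀ ^ 2 + ∑ i ∈ Finset.Icc 1 N, h₀ * (α₀ i) ^ 2 / (2 * (i : ℝ) + 1)) :
    h = h₀ ∨
      -(um₀ / Real.sqrt (g * h₀)) ^ 2
        + 1 / 2 * ((h / h₀) ^ 2 + h / h₀)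
        + (∑ i ∈ Finset.Icc 1 N,
            (um₀ / Real.sqrt (g * h₀)) ^ 2 * (α₀ i / um₀) ^ 2 / (2 * (i : ℝ) + 1))
            * ((h / h₀) ^ 3 + (h / h₀) ^ 2 + h / h₀) = 0 := by
  obtain ⟨x, rfl⟩ : ∃ x, h = x * h₀ := ⟨h / h₀, by field_simp⟩
  have hx : 0 < x := pos_of_mul_pos_left hh hh₀.le
  have hum : um = um₀ / x := by
    rw [eq_div_iff hx.ne']
    apply mul_left_cancel₀ hh₀.ne'
    linarith
  have hα : ∀ i ∈ Finset.Icc 1 N, α i = α₀ i * x := by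
    intro i hi
    rw [Finset.mem_Icc] at hi
    apply mul_right_cancel₀ hh₀.ne'
    linarith [inv2 i hi.1 hi.2]
  have hFr : (um₀ / Real.sqrt (g * h₀)) ^ 2 = um₀ ^ 2 / (g * h₀) := by
    rw [div_pow, Real.sq_sqrt (by positivity)]
  set S := ∑ i ∈ Finset.Icc 1 N, (α₀ i) ^ 2 / (2 * (i : ℝ) + 1) with hS
  have sum_flux : ∑ i ∈ Finset.Icc 1 N, x * h₀ * (α i) ^ 2 / (2 * (i : ℝ) + 1)
      = h₀ * x ^ 3 * S := by
    rw [hS, Finset.mul_sum]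
    refine Finset.sum_congr rfl fun i hi => ?_
    rw [hα i hi]
    ring
  have sum_flux₀ : ∑ i ∈ Finset.Icc 1 N, h₀ * (α₀ i) ^ 2 / (2 * (i : ℝ) + 1) = h₀ * S := by
    rw [hS, Finset.mul_sum]
    exact Finset.sum_congr rfl fun i _ => by ring
  have sum_moment : ∑ i ∈ Finset.Icc 1 N,
      um₀ ^ 2 / (g * h₀) * (α₀ i / um₀) ^ 2 / (2 * (i : ℝ) + 1) = S / (g * h₀) := by
    rw [hS, Finset.sum_div]
    refine Finset.sum_congr rfl fun i _ => ?_
    field_simp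
  rw [hFr, sum_moment, mul_div_cancel_right₀ x hh₀.ne']
  rw [sum_flux, sum_flux₀, hum] at inv3
  rcases eq_or_ne x 1 with rfl | hx1
  · exact Or.inl (one_mul h₀)
  right
  have flux : h₀ * um₀ ^ 2 / x = x * h₀ * (um₀ / x) ^ 2 := by field_simp
  rw [← flux] at inv3
  have key : (x - 1) * (-um₀ ^ 2 + 1 / 2 * (g * h₀) * (x ^ 2 + x)
      + S * (x ^ 3 + x ^ 2 + x)) = 0 := by
    apply mul_left_cancel₀ hh₀.ne'
    have hinv : h₀ * um₀ ^ 2 / x * x = h₀ * um₀ ^ 2 := div_mul_cancel₀ _ hx.ne'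
    linear_combination x * inv3 - hinv
  have quotient := (mul_eq_zero.mp key).resolve_left (sub_ne_zero.mpr hx1)
  have hgh : g * h₀ ≠ 0 := by positivity
  calc _ = (-um₀ ^ 2 + 1 / 2 * (g * h₀) * (x ^ 2 + x) + S * (x ^ 3 + x ^ 2 + x)) / (g * h₀) := by
        field_simp
    _ = 0 := by rw [quotient, zero_div]
end
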